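/- arXiv:2604.07016 — 3 statements merged into one kernel-verified Lean document; each statement's English description precedes it below -/
import Mathlib

section
/- Let S be a set, A a set with at least two elements, and let φ₁ : S → Φ₁ and φ₂ : S → Φ₂ be state abstractions. Then φ₁ is finer than φ₂ if and only if every policy derived from φ₂ is also derived from φ₁, i.e. Π_δ(φ₂) ⊆ Π_δ(φ₁). -/
/-- The set of policies on `S` derived from a state abstraction `φ : S → Φ`:
those that factor through `φ` via some abstract policy `π : Φ → PMF A`. -/
def DerivedPolicies {S Φ A : Type*} (φ : S → Φ) : Set (S → PMF A) :=
  {δ | ∃ π : Φ → PMF A, ∀ s, δ s = π (φ s)}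

/-- `φ₁` is finer than `φ₂`: states equivalent under `φ₁` are equivalent under `φ₂`. -/
def Finer {S Φ₁ Φ₂ : Type*} (φ₁ : S → Φ₁) (φ₂ : S → Φ₂) : Prop :=
  ∀ s t : S, φ₁ s = φ₁ t → φ₂ s = φ₂ t

/-- control granularity–coarseness trade-off: for an action set with
at least two elements, `φ₁` is finer than `φ₂` iff every policy derived from `φ₂` is
also derived from `φ₁`. -/
theorem finer_iff_derived_subset
    {S Φ₁ Φ₂ A : Type*} [Nontrivial A] (φ₁ : S → Φ₁) (φ₂ : S → Φ₂) :
    Finer φ₁ φ₂ ↔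
      (DerivedPolicies φ₂ : Set (S → PMF A)) ⊆ (DerivedPolicies φ₁ : Set (S → PMF A)) := by
  classical
  obtain ⟨a, b, hab⟩ := exists_pair_ne A
  constructor
  · rintro h δ ⟨π, hπ⟩
    refine ⟨fun x => if hx : ∃ s, φ₁ s = x then π (φ₂ hx.choose) else PMF.pure a, fun s => ?_⟩
    have hx : ∃ t, φ₁ t = φ₁ s := ⟨s, rfl⟩
    beta_reduce
    rw [dif_pos hx, hπ s, h _ _ hx.choose_spec]
  · intro h s t hst
    by_contra hne
    obtain ⟨π, hπ⟩ := h (show (fun u => if φ₂ u = φ₂ s then PMF.pure a else PMF.pure b) ∈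
      (DerivedPolicies φ₂ : Set (S → PMF A)) from
      ⟨fun x => if x = φ₂ s then PMF.pure a else PMF.pure b, fun _ => rfl⟩)
    have h1 := hπ s
    have h2 := hπ t
    rw [← hst, ← h1] at h2
    simp only [if_neg (Ne.symm hne), if_true] at h2
    have h3 := congrArg (fun p : PMF A => p a) h2
    simp [PMF.pure_apply, hab] at h3
end

section
/- Let M = ⟨S, A, p, r⟩ be an MDP with discount factor γ ∈ [0, 1), and let φ : S → Φ and φ' : S → Φ' be state abstractions. If φ has strictly greater transfer value for M than φ', then there exist states s, t ∈ S such that: (1) φ(s) ≠ φ(t); (2) φ'(s) = φ'(t); (3) there exists a derived policy δ ∈ Π_δ(φ) with δ(s) ≠ δ(t); and (4) every derived policy δ' ∈ Π_δ(φ') satisfies δ'(s) = δ'(t). -/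
open scoped BigOperators

noncomputable section

/-- Distribution of the state `S_k` of the Markov chain induced by policy `π`
and transition dynamics `p`, started at `s`. -/
def stateDist {S A : Type*} (p : S → A → PMF S) (π : S → PMF A) : ℕ → S → PMF S
  | 0, s => PMF.pure s
  | k + 1, s => (stateDist p π k s).bind fun t => (π t).bind fun a => p t a

/-- The value `v_π(s) = Σ_{k≥0} γ^k E[r(S_k, A_k)]` of a policy `π` at state `s`. -/
def policyValue {S A : Type*} [Fintype S] [Fintype A]
    (p : S → A → PMF S) (r : S → A → ℝ) (γ : ℝ) (π : S → PMF A) (s : S) : ℝ :=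
  ∑' k : ℕ, γ ^ k * ∑ t, ((stateDist p π k s) t).toReal * ∑ a, ((π t) a).toReal * r t a

/-- `φ` has strictly greater transfer value for the MDP `(p, r)` with discount `γ`
than `φ'`. -/
def StrictlyGreaterTransferValue {S A Φ Φ' : Type*} [Fintype S] [Fintype A]
    (p : S → A → PMF S) (r : S → A → ℝ) (γ : ℝ) (φ : S → Φ) (φ' : S → Φ') : Prop :=
  ∃ δ ∈ (DerivedPolicies φ : Set (S → PMF A)),
    ∀ δ' ∈ (DerivedPolicies φ' : Set (S → PMF A)),
      (∀ s, policyValue p r γ δ' s ≤ policyValue p r γ δ s) ∧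
      (∃ s, policyValue p r γ δ' s < policyValue p r γ δ s)

/-- transfer value–control trade-off: if `φ` has strictly greater
transfer value for the MDP than `φ'`, then there exist states `s, t` such that
(1) `φ s ≠ φ t`, (2) `φ' s = φ' t`, (3) some derived policy of `φ` distinguishes
`s` and `t`, and (4) no derived policy of `φ'` does. -/
theorem transfer_value_control_tradeoff
    {S A Φ Φ' : Type*} [Fintype S] [Fintype A] [Nonempty S] [Nonempty A]
    (p : S → A → PMF S) (r : S → A → ℝ) (γ : ℝ) (hγ0 : 0 ≤ γ) (hγ1 : γ < 1)
    (φ : S → Φ) (φ' : S → Φ')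
    (h : StrictlyGreaterTransferValue p r γ φ φ') :
    ∃ s t : S,
      φ s ≠ φ t ∧
      φ' s = φ' t ∧
      (∃ δ ∈ (DerivedPolicies φ : Set (S → PMF A)), δ s ≠ δ t) ∧
      (∀ δ' ∈ (DerivedPolicies φ' : Set (S → PMF A)), δ' s = δ' t) := by
  classical
  obtain ⟨δ, hδ, hlt⟩ := h
  have key : ∃ s t : S, φ' s = φ' t ∧ δ s ≠ δ t := by
    by_contra hcon
    have hcon' : ∀ s t : S, φ' s = φ' t → δ s = δ t := by
      intro s t hst
      by_contra hne
      exact hcon ⟨s, t, hst, hne⟩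
    have hmem : δ ∈ (DerivedPolicies φ' : Set (S → PMF A)) := by
      refine ⟨fun x => if hx : ∃ s, φ' s = x then δ hx.choose
        else PMF.pure (Classical.arbitrary A), fun s => ?_⟩
      have hx : ∃ u, φ' u = φ' s := ⟨s, rfl⟩
      simp only [dif_pos hx]
      exact hcon' _ _ hx.choose_spec.symm
    obtain ⟨s, hs⟩ := (hlt δ hmem).2
    exact lt_irrefl _ hs
  obtain ⟨s, t, hst, hne⟩ := key
  refine ⟨s, t, ?_, hst, ⟨δ, hδ, hne⟩, ?_⟩
  · intro he
    obtain ⟨π, hπ⟩ := hδ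
    exact hne (by rw [hπ s, hπ t, he])
  · rintro δ' ⟨π, hπ⟩
    rw [hπ s, hπ t, hst]
end
end

section
/- Let M = ⟨S, A, p, r⟩ be an MDP with finite state set S, finite nonempty action set A, and outcome function σ : S × A × S → ℝ^d, and let φ : S → Φ be an outcome equivalent state abstraction. Let M_φ be any abstract MDP for M and φ, determined by a weighting w : S → [0,1] with Σ_{s ∈ φ⁻¹(ψ)} w(s) = 1 for each ψ ∈ Φ. Define, for an abstract state ψ, n ∈ ℕ, action sequence (a₁, …, aₙ) ∈ Aⁿ and 1 ≤ k ≤ n, the k-th abstract expected outcome as Σ_{ψ₁, …, ψ_{k-1} ∈ Φ} p_φ(ψ₁ | ψ, a₁) ⋯ p_φ(ψ_{k-1} | ψ_{k-2}, a_{k-1}) · Σ_{s ∈ φ⁻¹(ψ_{k-1})} Σ_{s' ∈ S} w(s) p(s' | s, a_k) σ(s, a_k, s'). Then every ground state s ∈ S is outcome equivalent with its abstract state: for every n, every (a₁, …, aₙ) ∈ Aⁿ, and every k ≤ n, the k-th abstract expected outcome from ψ = φ(s) equals the k-th entry of the ground expected outcome sequence ⟨σ⟩(s, (a₁, …, aₙ))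 in M. In particular this holds for every admissible weighting w. -/
open scoped BigOperators

noncomputable section

/-- Distribution of the state reached after following a fixed list of actions
from state `s` under transition dynamics `p`. -/
def chainDist {S A : Type*} (p : S → A → PMF S) : List A → S → PMF S
  | [], s => PMF.pure s
  | a :: as, s => (p s a).bind (chainDist p as)

/-- The `k`-th entry of the expected outcome sequence `⟨σ⟩(s, as)`. -/
def expOutcomeEntry {S A : Type*} [Fintype S] {d : ℕ} (p : S → A → PMF S)
    (σ : S → A → S → Fin d → ℝ) (s : S) {n : ℕ} (as : Fin n → A) (k : Fin n) :
    Fin d → ℝ :=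
  fun i =>
    ∑ t, ((chainDist p (List.ofFn fun j : Fin (k : ℕ) => as (Fin.castLE k.isLt.le j)) s) t).toReal *
      ∑ t', ((p t (as k)) t').toReal * σ t (as k) t' i

/-- Two states are outcome equivalent. -/
def OutcomeEquiv {S A : Type*} [Fintype S] [Fintype A] {d : ℕ}
    (p : S → A → PMF S) (σ : S → A → S → Fin d → ℝ) (s t : S) : Prop :=
  ∀ (n : ℕ) (as : Fin n → A) (k : Fin n),
    expOutcomeEntry p σ s as k = expOutcomeEntry p σ t as k

/-- Transition dynamics of the abstract MDP `M_φ` determined by the weighting `w`: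
`p_φ(ψ' | ψ, a) = Σ_{s ∈ φ⁻¹(ψ)} Σ_{s' ∈ φ⁻¹(ψ')} w(s) p(s' | s, a)`. -/
def pAbs {S A Φ : Type*} [Fintype S] [DecidableEq Φ] (p : S → A → PMF S)
    (φ : S → Φ) (w : S → ℝ) (ψ : Φ) (a : A) (ψ' : Φ) : ℝ :=
  ∑ s, if φ s = ψ then w s * ∑ s', (if φ s' = ψ' then ((p s a) s').toReal else 0) else 0

/-- Probability of reaching abstract state `ψ'` from `ψ` after following a fixed
list of actions in the abstract MDP. -/
def absChainDist {S A Φ : Type*} [Fintype S] [Fintype Φ] [DecidableEq Φ]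
    (p : S → A → PMF S) (φ : S → Φ) (w : S → ℝ) : List A → Φ → Φ → ℝ
  | [], ψ, ψ' => if ψ' = ψ then 1 else 0
  | a :: as, ψ, ψ' => ∑ ψ₁, pAbs p φ w ψ a ψ₁ * absChainDist p φ w as ψ₁ ψ'

/-- The `k`-th abstract expected outcome from abstract state `ψ`, following the
action sequence `as`:
`Σ_{ψ₁,…,ψ_{k-1}} p_φ(ψ₁|ψ,a₁)⋯p_φ(ψ_{k-1}|ψ_{k-2},a_{k-1}) ·
  Σ_{s ∈ φ⁻¹(ψ_{k-1})} Σ_{s'} w(s) p(s'|s,a_k) σ(s,a_k,s')`. -/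
def absExpOutcomeEntry {S A Φ : Type*} [Fintype S] [Fintype Φ] [DecidableEq Φ] {d : ℕ}
    (p : S → A → PMF S) (σ : S → A → S → Fin d → ℝ) (φ : S → Φ) (w : S → ℝ)
    (ψ : Φ) {n : ℕ} (as : Fin n → A) (k : Fin n) : Fin d → ℝ :=
  fun i =>
    ∑ ψ', absChainDist p φ w (List.ofFn fun j : Fin (k : ℕ) => as (Fin.castLE k.isLt.le j)) ψ ψ' *
      ∑ s, if φ s = ψ' then w s * ∑ s', ((p s (as k)) s').toReal * σ s (as k) s' i else 0

theorem aux_chain_cons {S A : Type*} [Fintype S] (p : S → A → PMF S) (g : S → ℝ)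
    (a : A) (l : List A) (s : S) :
    ∑ t, (chainDist p (a :: l) s t).toReal * g t =
      ∑ s', (p s a s').toReal * ∑ t, (chainDist p l s' t).toReal * g t := by
  have h : ∀ t, (chainDist p (a :: l) s t).toReal =
      ∑ s', (p s a s').toReal * (chainDist p l s' t).toReal := by
    intro t
    rw [chainDist, PMF.bind_apply, tsum_fintype, ENNReal.toReal_sum]
    · simp [ENNReal.toReal_mul]
    · intro x _
      exact ENNReal.mul_ne_top (PMF.apply_ne_top _ _) (PMF.apply_ne_top _ _)
  simp_rw [h, Finset.sum_mul, Finset.mul_sum]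
  rw [Finset.sum_comm]
  simp only [mul_assoc]

theorem aux_chain_nil {S A : Type*} [Fintype S] (p : S → A → PMF S) (g : S → ℝ) (s : S) :
    ∑ t, (chainDist p ([] : List A) s t).toReal * g t = g s := by
  classical
  rw [Finset.sum_eq_single s]
  · simp [chainDist]
  · intro b _ hb
    simp [chainDist, PMF.pure_apply, hb]
  · simp

theorem aux_weight {S Φ : Type*} [Fintype S] [DecidableEq Φ] (φ : S → Φ) (w : S → ℝ)
    (hwsum : ∀ ψ : Φ, (∑ s, if φ s = ψ then w s else 0) = 1) (G : S → ℝ)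
    (hG : ∀ s t, φ s = φ t → G s = G t) (s : S) :
    (∑ x, if φ x = φ s then w x * G x else 0) = G s := by
  calc (∑ x, if φ x = φ s then w x * G x else 0)
      = ∑ x, (if φ x = φ s then w x else 0) * G s := by
        refine Finset.sum_congr rfl fun x _ => ?_
        split_ifs with h
        · rw [hG x s h]
        · simp
    _ = G s := by rw [← Finset.sum_mul, hwsum, one_mul]

theorem aux_main {S A Φ : Type*} [Fintype S] [Fintype Φ] [DecidableEq Φ]
    (p : S → A → PMF S) (φ : S → Φ) (w : S → ℝ)
    (hwsum : ∀ ψ : Φ, (∑ s, if φ s = ψ then w s else 0) = 1) (g : S → ℝ)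
    (H : ∀ (l : List A) s t, φ s = φ t →
      ∑ x, (chainDist p l s x).toReal * g x = ∑ x, (chainDist p l t x).toReal * g x)
    (l : List A) : ∀ s : S,
    ∑ ψ', absChainDist p φ w l (φ s) ψ' * (∑ x, if φ x = ψ' then w x * g x else 0) =
      ∑ x, (chainDist p l s x).toReal * g x := by
  induction l with
  | nil =>
    intro s
    rw [aux_chain_nil]
    simp only [absChainDist, ite_mul, one_mul, zero_mul, Finset.sum_ite_eq', Finset.mem_univ,
      if_true]
    refine aux_weight φ w hwsum g (fun s t h => ?_) s
    simpa only [aux_chain_nil] using H [] s t h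
  | cons a l ih =>
    intro s
    rw [← aux_weight φ w hwsum (fun s => ∑ x, (chainDist p (a :: l) s x).toReal * g x)
      (H (a :: l)) s]
    simp only [aux_chain_cons, ← ih]
    generalize (fun ψ' => ∑ x, if φ x = ψ' then w x * g x else 0) = W
    have e : ∀ (W : Φ → ℝ), ∑ ψ', absChainDist p φ w (a :: l) (φ s) ψ' * W ψ' =
        ∑ x, if φ x = φ s then w x * ∑ s', (p x a s').toReal *
          ∑ ψ', absChainDist p φ w l (φ s') ψ' * W ψ' else 0 := by
      intro W
      have e1 : ∑ ψ', absChainDist p φ w (a :: l) (φ s) ψ' * W ψ' =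
          ∑ ψ₁, pAbs p φ w (φ s) a ψ₁ * ∑ ψ', absChainDist p φ w l ψ₁ ψ' * W ψ' := by
        simp only [absChainDist, Finset.sum_mul, Finset.mul_sum]
        rw [Finset.sum_comm]
        simp only [mul_assoc]
      rw [e1]
      generalize (fun ψ₁ => ∑ ψ', absChainDist p φ w l ψ₁ ψ' * W ψ') = F
      have e2 : ∀ F : Φ → ℝ, ∑ ψ₁, pAbs p φ w (φ s) a ψ₁ * F ψ₁ =
          ∑ x, if φ x = φ s then w x * ∑ s', (p x a s').toReal * F (φ s') else 0 := by
        intro F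
        simp only [pAbs, Finset.sum_mul]
        rw [Finset.sum_comm]
        refine Finset.sum_congr rfl fun x _ => ?_
        split_ifs with h
        · simp only [mul_assoc, ← Finset.mul_sum, Finset.sum_mul]
          rw [Finset.sum_comm]
          simp
        · simp
      exact e2 _
    exact e _

/-- for an outcome equivalent state abstraction `φ` and any abstract
MDP determined by an admissible weighting `w`, every ground state is outcome
equivalent with its abstract state: each abstract expected outcome from `φ(s)`
equals the corresponding entry of the ground expected outcome sequence from `s`. -/
theorem abstract_ground_outcome_equivalent
    {S A Φ : Type*} [Fintype S] [Fintype A] [Fintype Φ] [DecidableEq Φ]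
    [Nonempty S] [Nonempty A] {d : ℕ}
    (p : S → A → PMF S) (r : S → A → ℝ)
    (σ : S → A → S → Fin d → ℝ) (φ : S → Φ)
    (hφ : ∀ s t : S, φ s = φ t → OutcomeEquiv p σ s t)
    (w : S → ℝ) (hw0 : ∀ s, 0 ≤ w s) (hw1 : ∀ s, w s ≤ 1)
    (hwsum : ∀ ψ : Φ, (∑ s, if φ s = ψ then w s else 0) = 1) :
    ∀ (s : S) (n : ℕ) (as : Fin n → A) (k : Fin n),
      absExpOutcomeEntry p σ φ w (φ s) as k = expOutcomeEntry p σ s as k := by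
  intro s n as k
  funext i
  refine aux_main p φ w hwsum
    (fun x => ∑ s', ((p x (as k)) s').toReal * σ x (as k) s' i) ?_ _ s
  intro l x y hxy
  have h := congrFun (hφ x y hxy (l.length + 1) (Fin.snoc (α := fun _ => A) l.get (as k))
    (Fin.last l.length)) i
  have hl : (List.ofFn fun j : Fin ((Fin.last l.length : Fin (l.length + 1)) : ℕ) =>
      (Fin.snoc (α := fun _ => A) l.get (as k) : Fin (l.length + 1) → A)
        (Fin.castLE (Fin.last l.length).isLt.le j)) = l := by
    have : (fun j : Fin l.length =>
      (Fin.snoc (α := fun _ => A) l.get (as k) : Fin (l.length + 1) → A)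
        (Fin.castSucc j)) = l.get := by
      funext j
      simp only [Fin.snoc_castSucc]
    exact (congrArg List.ofFn this).trans (List.ofFn_get l)
  unfold expOutcomeEntry at h
  rw [hl] at h
  simpa only [Fin.snoc_last] using h
end
end
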